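/- arXiv:2407.01402 — 2 statements merged into one kernel-verified Lean document; each statement's English description precedes it below -/
import Mathlib

section
/- Let D ⊆ {0,1}^n, let f : D → {0,1} be a partial Boolean function, and let T be any decision tree over {0,1}^n. Then DT(f) ≤ |T| + Σ_{x ∈ f⁻¹(1)} Cert(f_{π(x)}, x), where π(x) denotes the restriction given by the root-to-leaf path followed by x in T and f_{π(x)} is the restriction of f by π(x). -/
open Finset

attribute [local instance] Classical.propDecidable

/-- A binary decision tree querying coordinates of type `ι`. -/
inductive DTree (ι : Type) : Type where
  | leaf : Bool → DTree ι
  | node : ι → DTree ι → DTree ι → DTree ι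

namespace DTree

/-- Evaluation of a decision tree on an input. -/
def eval {ι : Type} : DTree ι → (ι → Bool) → Bool
  | .leaf b, _ => b
  | .node i t0 t1, x => if x i then t1.eval x else t0.eval x

/-- The size of a decision tree is its number of leaves. -/
def size {ι : Type} : DTree ι → ℕ
  | .leaf _ => 1
  | .node _ t0 t1 => t0.size + t1.size

/-- The restriction (set of literals) given by the root-to-leaf path followed by `x` in `T`. -/
noncomputable def pathRes {ι : Type} : DTree ι → (ι → Bool) → (ι → Option Bool)
  | .leaf _, _ => fun _ => none
  | .node i t0 t1, x =>
      Function.update (if x i then t1.pathRes x else t0.pathRes x) i (some (x i))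

end DTree

/-- Apply a restriction to an input: coordinates fixed by `ρ` take their fixed value. -/
def override {ι : Type} (ρ : ι → Option Bool) (x : ι → Bool) : ι → Bool :=
  fun i => (ρ i).getD (x i)

/-- The number of literals in a restriction. -/
noncomputable def resSize {ι : Type} [Fintype ι] (ρ : ι → Option Bool) : ℕ :=
  (Finset.univ.filter fun i => (ρ i).isSome).card

/-- A restriction `ρ` is consistent with the input `x`. -/
def Consistent {ι : Type} (ρ : ι → Option Bool) (x : ι → Bool) : Prop :=
  ∀ i b, ρ i = some b → x i = b

/-- `T` computes the partial function (represented by the total function `f`) on domain `D`. -/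
def Computes {ι : Type} (T : DTree ι) (f : (ι → Bool) → Bool) (D : Finset (ι → Bool)) : Prop :=
  ∀ x ∈ D, T.eval x = f x

/-- `DT(f)`: the minimal size of a decision tree computing the partial function `f : D → {0,1}`. -/
noncomputable def DTsize {ι : Type} (f : (ι → Bool) → Bool) (D : Finset (ι → Bool)) : ℕ :=
  sInf {s | ∃ T : DTree ι, Computes T f D ∧ T.size = s}

/-- The domain of the subfunction `f_ρ`: inputs whose `ρ`-override lies in `D`. -/
noncomputable def restrictD {ι : Type} [Fintype ι] (D : Finset (ι → Bool)) (ρ : ι → Option Bool) :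
    Finset (ι → Bool) :=
  Finset.univ.filter fun x => override ρ x ∈ D

/-- The subfunction `f_ρ` of `f` obtained by fixing variables according to `ρ`. -/
def restrictF {ι : Type} (f : (ι → Bool) → Bool) (ρ : ι → Option Bool) : (ι → Bool) → Bool :=
  fun x => f (override ρ x)

/-- The partial function `f : D → {0,1}` is constant on its domain. -/
def IsConstOn {ι : Type} (f : (ι → Bool) → Bool) (D : Finset (ι → Bool)) : Prop :=
  ∀ x ∈ D, ∀ y ∈ D, f x = f y

/-- `Cert(f, x)`: the minimal number of literals of a restriction `ρ` consistent with `x`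
such that `f_ρ` is constant on its domain. -/
noncomputable def Cert {ι : Type} [Fintype ι] (f : (ι → Bool) → Bool) (D : Finset (ι → Bool))
    (x : ι → Bool) : ℕ :=
  sInf {k | ∃ ρ : ι → Option Bool, Consistent ρ x ∧
    IsConstOn (restrictF f ρ) (restrictD D ρ) ∧ resSize ρ = k}

/-- `x` with bit `i` flipped. -/
noncomputable def flipBit {ι : Type} (x : ι → Bool) (i : ι) : ι → Bool :=
  Function.update x i (!(x i))

/-- `Sens(f, x)`: the set of sensitive neighbors of `x` that lie in the domain `D`. -/
noncomputable def sensSet {ι : Type} [Fintype ι] (f : (ι → Bool) → Bool) (D : Finset (ι → Bool))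
    (x : ι → Bool) : Finset (ι → Bool) :=
  D.filter fun y => (∃ i, y = flipBit x i) ∧ f y ≠ f x

/-- `Sens(f)`: the maximum sensitivity of the partial function `f : D → {0,1}`. -/
noncomputable def maxSens {ι : Type} [Fintype ι] (f : (ι → Bool) → Bool)
    (D : Finset (ι → Bool)) : ℕ :=
  D.sup fun x => (sensSet f D x).card

/-- `error_𝒟(T, f) = Pr_{x ∼ 𝒟}[T(x) ≠ f(x)]`, for a distribution given by its
probability mass function `𝒟`. -/
noncomputable def errD {ι : Type} [Fintype ι] (𝒟 : (ι → Bool) → ℝ) (T : DTree ι)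
    (f : (ι → Bool) → Bool) : ℝ :=
  ∑ x : ι → Bool, 𝒟 x * (if T.eval x = f x then 0 else 1)

lemma Consistent.override_eq {ι : Type} {ρ : ι → Option Bool} {x : ι → Bool}
    (h : Consistent ρ x) : override ρ x = x := by
  funext i
  unfold override
  cases hi : ρ i with
  | none => rfl
  | some b => exact (h i b hi).symm

lemma Consistent.update {ι : Type} {ρ : ι → Option Bool} {x : ι → Bool} (h : Consistent ρ x)
    {i : ι} {b : Bool} (hi : x i = b) : Consistent (Function.update ρ i (some b)) x := by
  intro j c hj
  by_cases hji : j = i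
  · subst hji
    simp only [Function.update_self, Option.some.injEq] at hj
    exact hi.trans hj
  · rw [Function.update_of_ne hji] at hj
    exact h j c hj

lemma DTree.consistent_pathRes {ι : Type} (T : DTree ι) (x : ι → Bool) :
    Consistent (T.pathRes x) x := by
  induction T with
  | leaf b => intro i c h; simp [DTree.pathRes] at h
  | node i t0 t1 ih0 ih1 =>
    unfold DTree.pathRes
    refine Consistent.update ?_ rfl
    split_ifs
    exacts [ih1, ih0]

/-- The minimum defining `Cert f D x` is attained. -/
lemma exists_resSize_eq_cert {ι : Type} [Fintype ι] (f : (ι → Bool) → Bool)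
    (D : Finset (ι → Bool)) (x : ι → Bool) :
    ∃ ρ : ι → Option Bool, Consistent ρ x ∧
      IsConstOn (restrictF f ρ) (restrictD D ρ) ∧ resSize ρ = Cert f D x := by
  refine Nat.sInf_mem (s := {k | ∃ ρ : ι → Option Bool, Consistent ρ x ∧
    IsConstOn (restrictF f ρ) (restrictD D ρ) ∧ resSize ρ = k})
    ⟨_, fun i => some (x i), fun i b h => Option.some.inj h, fun y _ z _ => rfl, rfl⟩

/-- Trees computing `f` on the two halves of `D` given by coordinate `i` combine into a tree
computing `f` on `D`. -/
lemma Computes.node {ι : Type} {f : (ι → Bool) → Bool} {D : Finset (ι → Bool)} {i : ι}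
    {t0 t1 : DTree ι} (h1 : Computes t1 f (D.filter fun x => x i = true))
    (h0 : Computes t0 f (D.filter fun x => ¬ x i = true)) :
    Computes (DTree.node i t0 t1) f D := by
  intro x hx
  by_cases hi : x i = true
  · simpa [DTree.eval, hi] using h1 x (by simp [hx, hi])
  · simpa [DTree.eval, hi] using h0 x (by simp [hx, hi])

lemma sum_filter_coord_add {ι : Type} (f : (ι → Bool) → Bool) (D : Finset (ι → Bool)) (i : ι)
    (g : (ι → Bool) → ℕ) :
    ∑ x ∈ (D.filter fun x => x i = true).filter (fun x => f x = true), g x +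
      ∑ x ∈ (D.filter fun x => ¬ x i = true).filter (fun x => f x = true), g x =
      ∑ x ∈ D.filter (fun x => f x = true), g x := by
  rw [Finset.filter_comm, Finset.filter_comm (fun x : ι → Bool => ¬ x i = true)]
  exact Finset.sum_filter_add_sum_filter_not _ _ _

/-- If every `1`-input `x` of `f` is certified by its coordinates in `S x`, then `f` has a decision
tree of size at most one plus the total size of the certificates. -/
lemma exists_computes_of_certificates {ι : Type} (f : (ι → Bool) → Bool) (m : ℕ) :
    ∀ (D : Finset (ι → Bool)) (S : (ι → Bool) → Finset ι),
      (∀ x ∈ D, f x = true → ∀ y ∈ D, (∀ i ∈ S x, y i = x i) → f y = true) →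
      ∑ x ∈ D.filter (fun x => f x = true), (S x).card ≤ m →
      ∃ T : DTree ι, Computes T f D ∧
        T.size ≤ 1 + ∑ x ∈ D.filter (fun x => f x = true), (S x).card := by
  induction m using Nat.strong_induction_on with
  | _ m ih =>
    intro D S hS hm
    by_cases hD : ∃ x ∈ D, f x = true
    swap
    · push Not at hD
      exact ⟨.leaf false, fun x hx => by simpa [DTree.eval] using (hD x hx), by simp [DTree.size]⟩
    obtain ⟨x, hx, hfx⟩ := hD
    rcases (S x).eq_empty_or_nonempty with hSx | ⟨i, hi⟩
    · exact ⟨.leaf true, fun y hy => (hS x hx hfx y hy (by simp [hSx])).symm, by simp [DTree.size]⟩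
    have hlt : ∑ y ∈ D.filter (fun y => f y = true), ((S y).erase i).card <
        ∑ y ∈ D.filter (fun y => f y = true), (S y).card :=
      Finset.sum_lt_sum (fun y _ => Finset.card_erase_le)
        ⟨x, by simp [hx, hfx], Finset.card_erase_lt_of_mem hi⟩
    have hsum := sum_filter_coord_add f D i fun y => ((S y).erase i).card
    obtain ⟨t1, hc1, hs1⟩ := ih (m - 1) (by omega) (D.filter fun y => y i = true)
      (fun y => (S y).erase i) (by
        intro y hy hfy z hz hzy
        rw [Finset.mem_filter] at hy hz
        refine hS y hy.1 hfy z hz.1 fun j hj => ?_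
        by_cases hji : j = i
        · rw [hji, hz.2, hy.2]
        · exact hzy j (Finset.mem_erase.2 ⟨hji, hj⟩)) (by omega)
    obtain ⟨t0, hc0, hs0⟩ := ih (m - 1) (by omega) (D.filter fun y => ¬ y i = true)
      (fun y => (S y).erase i) (by
        intro y hy hfy z hz hzy
        rw [Finset.mem_filter, Bool.not_eq_true] at hy hz
        refine hS y hy.1 hfy z hz.1 fun j hj => ?_
        by_cases hji : j = i
        · rw [hji, hz.2, hy.2]
        · exact hzy j (Finset.mem_erase.2 ⟨hji, hj⟩)) (by omega)
    exact ⟨.node i t0 t1, hc1.node hc0, by simp only [DTree.size]; omega⟩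

/-- Patching a decision tree `T`: if every `1`-input `x` is certified, among the inputs consistent
with its path in `T`, by its coordinates in `S x`, then `f` has a decision tree of size at most
the size of `T` plus the total size of the certificates. -/
lemma exists_computes_of_path_certificates {ι : Type} (f : (ι → Bool) → Bool)
    (S : (ι → Bool) → Finset ι) (T : DTree ι) :
    ∀ D : Finset (ι → Bool),
      (∀ x ∈ D, f x = true → ∀ y ∈ D, Consistent (T.pathRes x) y →
        (∀ i ∈ S x, y i = x i) → f y = true) →
      ∃ T' : DTree ι, Computes T' f D ∧
        T'.size ≤ T.size + ∑ x ∈ D.filter (fun x => f x = true), (S x).card := by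
  induction T with
  | leaf b =>
    intro D hS
    exact exists_computes_of_certificates f _ D S
      (fun x hx hfx y hy => hS x hx hfx y hy fun i c h => by simp [DTree.pathRes] at h) le_rfl
  | node i t0 t1 ih0 ih1 =>
    intro D hS
    obtain ⟨s1, hc1, hs1⟩ := ih1 (D.filter fun y => y i = true) (by
      intro x hx hfx y hy hxy
      rw [Finset.mem_filter] at hx hy
      refine hS x hx.1 hfx y hy.1 ?_
      rw [DTree.pathRes, if_pos hx.2]
      exact hxy.update (hy.2.trans hx.2.symm))
    obtain ⟨s0, hc0, hs0⟩ := ih0 (D.filter fun y => ¬ y i = true) (by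
      intro x hx hfx y hy hxy
      rw [Finset.mem_filter] at hx hy
      refine hS x hx.1 hfx y hy.1 ?_
      rw [DTree.pathRes, if_neg hx.2]
      exact hxy.update (by simp_all))
    have hsum := sum_filter_coord_add f D i fun y => (S y).card
    exact ⟨.node i s0 s1, hc1.node hc0, by simp only [DTree.size]; omega⟩

/-- patch up lemma: for a partial Boolean function `f : D → {0,1}` and any
decision tree `T`, `DT(f) ≤ |T| + Σ_{x ∈ f⁻¹(1)} Cert(f_{π(x)}, x)`, where `π(x)` is the
restriction given by the path followed by `x` in `T`. -/
theorem stmt1 {n : ℕ} (D : Finset (Fin n → Bool)) (f : (Fin n → Bool) → Bool)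
    (T : DTree (Fin n)) :
    DTsize f D ≤ T.size + ∑ x ∈ D.filter (fun x => f x = true),
      Cert (restrictF f (T.pathRes x)) (restrictD D (T.pathRes x)) x := by
  choose ρ hρx hρconst hρsize using fun x =>
    exists_resSize_eq_cert (restrictF f (T.pathRes x)) (restrictD D (T.pathRes x)) x
  obtain ⟨T', hT', hsize⟩ := exists_computes_of_path_certificates f
    (fun x => Finset.univ.filter fun i => (ρ x i).isSome) T D (by
      intro x hx hfx y hy hxy hag
      have hρy : Consistent (ρ x) y := fun i b h =>
        (hag i (by simp [h])).trans (hρx x i b h)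
      have hox : override (T.pathRes x) (override (ρ x) x) = x := by
        rw [(hρx x).override_eq, (T.consistent_pathRes x).override_eq]
      have hoy : override (T.pathRes x) (override (ρ x) y) = y := by
        rw [hρy.override_eq, hxy.override_eq]
      have h := hρconst x y (by simpa [restrictD, hoy] using hy)
        x (by simpa [restrictD, hox] using hx)
      simp only [restrictF, hox, hoy] at h
      exact h.trans hfx)
  calc DTsize f D ≤ T'.size := Nat.sInf_le ⟨T', hT', rfl⟩
    _ ≤ _ := hsize
    _ = _ := by
      congr 1
      exact Finset.sum_congr rfl fun x _ => hρsize x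
end

section
/- Let G be a graph with at least one edge and let ℓ ≥ 1. Then the maximum sensitivity of the partial function ℓ-IsEdge_G : ℓ-D_G → {0,1} equals 2(ℓ+1); moreover every generalized edge indicator ℓ-Ind[e] satisfies |Sens(ℓ-IsEdge_G, ℓ-Ind[e])| = 2(ℓ+1), and every sensitive neighbor y of a generalized edge indicator satisfies |Sens(ℓ-IsEdge_G, y)| = 1. -/
open Finset

attribute [local instance] Classical.propDecidable

/-- The edge set of `G` as a `Finset`. -/
noncomputable def edgeFin {V : Type} [Fintype V] (G : SimpleGraph V) : Finset (Sym2 V) :=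
  Finset.univ.filter fun e => e ∈ G.edgeSet

/-- `K` is a vertex cover of `G`: every edge has at least one endpoint in `K`. -/
def IsVC {V : Type} (G : SimpleGraph V) (K : Finset V) : Prop :=
  ∀ e ∈ G.edgeSet, ∃ v ∈ K, v ∈ e

/-- The generalized edge indicator `ℓ-Ind[e] = (Ind[e], …, Ind[e])`, viewed as an element of
`{0,1}^{(ℓ+1) × n}` (block `0` is `v⁽⁰⁾` and blocks `1, …, ℓ` are `v⁽¹⁾, …, v⁽ˡ⁾`). -/
noncomputable def ellInd {n : ℕ} (ℓ : ℕ) (e : Sym2 (Fin n)) : Fin (ℓ + 1) × Fin n → Bool :=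
  fun p => decide (p.2 ∈ e)

/-- The `ℓ`-amplified edge indicator function `ℓ-IsEdge_G` (a total function). -/
noncomputable def ellIsEdge {n : ℕ} (G : SimpleGraph (Fin n)) (ℓ : ℕ)
    (z : Fin (ℓ + 1) × Fin n → Bool) : Bool :=
  decide ((∃ e ∈ G.edgeSet, ∀ i : Fin n, z (0, i) = decide (i ∈ e)) ∧
    (∀ i : Fin n, z (0, i) = true → ∀ j : Fin (ℓ + 1), z (j, i) = true))

/-- `ℓ-D_G`: all generalized edge indicators together with all strings obtained from one of
them by flipping exactly one `1`-coordinate to `0`. -/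
noncomputable def ellDom {n : ℕ} (G : SimpleGraph (Fin n)) (ℓ : ℕ) :
    Finset (Fin (ℓ + 1) × Fin n → Bool) :=
  Finset.univ.filter fun z => ∃ e ∈ G.edgeSet,
    z = ellInd ℓ e ∨ ∃ p, ellInd ℓ e p = true ∧ z = Function.update (ellInd ℓ e) p false

/-- The canonical hard distribution `ℓ-𝒟_G` (as a probability mass function): sample a
generalized edge indicator `ℓ-Ind[e]` uniformly at random; with probability `1/2` output it,
and with probability `1/2` output it with a uniformly random one of its `2(ℓ+1)` many
`1`-coordinates flipped to `0`. -/
noncomputable def ellDist {n : ℕ} (G : SimpleGraph (Fin n)) (ℓ : ℕ)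
    (z : Fin (ℓ + 1) × Fin n → Bool) : ℝ :=
  (∑ e ∈ edgeFin G, ((if z = ellInd ℓ e then (1 : ℝ) / 2 else 0) +
      ∑ p : Fin (ℓ + 1) × Fin n,
        if ellInd ℓ e p = true ∧ z = Function.update (ellInd ℓ e) p false
          then 1 / (4 * (ℓ + 1)) else 0)) / (edgeFin G).card

theorem flipBit_eq_update {ι : Type} [DecidableEq ι] (x : ι → Bool) (i : ι) :
    flipBit x i = Function.update x i (!(x i)) := by
  ext j
  simp [flipBit, Function.update_apply]

/-- Two edges that agree off a single vertex are equal. -/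
theorem edge_eq_of_agree_off {V : Type} {G : SimpleGraph V} {e e' : Sym2 V}
    (he : e ∈ G.edgeSet) (he' : e' ∈ G.edgeSet) (v : V)
    (h : ∀ i, i ≠ v → (i ∈ e ↔ i ∈ e')) : e = e' := by
  induction e with | _ a b
  induction e' with | _ c d
  have hab : a ≠ b := G.ne_of_adj he
  have hcd : c ≠ d := G.ne_of_adj he'
  simp only [Sym2.mem_iff] at h
  rw [Sym2.eq_iff]
  have ha := h a
  have hb := h b
  have hc := h c
  have hd := h d
  grind

theorem edge_eq_of_update_ellInd_eq {n : ℕ} {G : SimpleGraph (Fin n)} {ℓ : ℕ} (hℓ : 1 ≤ ℓ)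
    {e e' : Sym2 (Fin n)} (he : e ∈ G.edgeSet) (he' : e' ∈ G.edgeSet)
    {p q : Fin (ℓ + 1) × Fin n} {b c : Bool}
    (h : Function.update (ellInd ℓ e) p b = Function.update (ellInd ℓ e') q c) : e = e' := by
  have : Nontrivial (Fin (ℓ + 1)) := Fin.nontrivial_iff_two_le.2 (by omega)
  obtain ⟨j, hj⟩ := exists_ne q.1
  refine edge_eq_of_agree_off he he' p.2 fun i hi => ?_
  have hp : (j, i) ≠ p := fun hh => hi (congrArg Prod.snd hh)
  have hq : (j, i) ≠ q := fun hh => hj (congrArg Prod.fst hh)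
  have := congrFun h (j, i)
  rw [Function.update_of_ne hp, Function.update_of_ne hq] at this
  simpa [ellInd] using this

theorem ellIsEdge_ellInd {n : ℕ} {G : SimpleGraph (Fin n)} (ℓ : ℕ) {e : Sym2 (Fin n)}
    (he : e ∈ G.edgeSet) : ellIsEdge G ℓ (ellInd ℓ e) = true := by
  simp only [ellIsEdge, decide_eq_true_eq]
  exact ⟨⟨e, he, fun i => rfl⟩, fun i hi j => hi⟩

theorem ellIsEdge_update_ellInd {n : ℕ} {G : SimpleGraph (Fin n)} {ℓ : ℕ} {e : Sym2 (Fin n)}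
    (he : e ∈ G.edgeSet) {p : Fin (ℓ + 1) × Fin n} (hp : ellInd ℓ e p = true) :
    ellIsEdge G ℓ (Function.update (ellInd ℓ e) p false) = false := by
  simp only [ellIsEdge, decide_eq_false_iff_not]
  rintro ⟨⟨e', he', h⟩, h'⟩
  obtain ⟨j, v⟩ := p
  have hv : v ∈ e := by simpa [ellInd] using hp
  by_cases hj : j = 0
  · subst hj
    have hee : e = e' := by
      refine edge_eq_of_agree_off he he' v fun i hi => ?_
      have := h i
      rw [Function.update_of_ne (by simpa using hi)] at this
      simpa [ellInd] using this
    subst hee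
    have := h v
    simp [hv] at this
  · have h0 : ((0 : Fin (ℓ + 1)), v) ≠ (j, v) := fun hh => hj (congrArg Prod.fst hh).symm
    have := h' v (by rw [Function.update_of_ne h0]; simpa [ellInd] using hv) j
    simp at this

theorem ellInd_mem_ellDom {n : ℕ} {G : SimpleGraph (Fin n)} (ℓ : ℕ) {e : Sym2 (Fin n)}
    (he : e ∈ G.edgeSet) : ellInd ℓ e ∈ ellDom G ℓ := by
  simpa [ellDom] using ⟨e, he, Or.inl rfl⟩

theorem sensSet_ellInd {n : ℕ} {G : SimpleGraph (Fin n)} {ℓ : ℕ} (hℓ : 1 ≤ ℓ)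
    {e : Sym2 (Fin n)} (he : e ∈ G.edgeSet) :
    sensSet (ellIsEdge G ℓ) (ellDom G ℓ) (ellInd ℓ e) =
      (univ.filter fun p => ellInd ℓ e p = true).image
        fun p => Function.update (ellInd ℓ e) p false := by
  ext y
  simp only [sensSet, mem_filter, mem_image, mem_univ, true_and, ellIsEdge_ellInd ℓ he]
  constructor
  · rintro ⟨hy, ⟨i, hi⟩, hf⟩
    rw [flipBit_eq_update] at hi
    simp only [ellDom, mem_filter, mem_univ, true_and] at hy
    obtain ⟨e', he', rfl | ⟨p, hp, rfl⟩⟩ := hy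
    · exact absurd (ellIsEdge_ellInd ℓ he') hf
    · obtain rfl := edge_eq_of_update_ellInd_eq hℓ he' he hi
      exact ⟨p, hp, rfl⟩
  · rintro ⟨p, hp, rfl⟩
    refine ⟨?_, ⟨p, ?_⟩, ?_⟩
    · simp only [ellDom, mem_filter, mem_univ, true_and]
      exact ⟨e, he, Or.inr ⟨p, hp, rfl⟩⟩
    · rw [flipBit_eq_update, hp, Bool.not_true]
    · rw [ellIsEdge_update_ellInd he hp]
      exact Bool.false_ne_true

theorem card_ones_ellInd {n : ℕ} {G : SimpleGraph (Fin n)} (ℓ : ℕ) {e : Sym2 (Fin n)}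
    (he : e ∈ G.edgeSet) : (univ.filter fun p => ellInd ℓ e p = true).card = 2 * (ℓ + 1) := by
  induction e with | _ a b
  have hab : a ≠ b := G.ne_of_adj he
  have : (univ.filter fun p => ellInd ℓ s(a, b) p = true) =
      (univ : Finset (Fin (ℓ + 1))) ×ˢ ({a, b} : Finset (Fin n)) := by
    ext p
    simp [ellInd]
  rw [this, card_product, card_pair hab, card_univ, Fintype.card_fin, mul_comm]

theorem card_sensSet_ellInd {n : ℕ} {G : SimpleGraph (Fin n)} {ℓ : ℕ} (hℓ : 1 ≤ ℓ)
    {e : Sym2 (Fin n)} (he : e ∈ G.edgeSet) :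
    (sensSet (ellIsEdge G ℓ) (ellDom G ℓ) (ellInd ℓ e)).card = 2 * (ℓ + 1) := by
  rw [sensSet_ellInd hℓ he, card_image_of_injOn, card_ones_ellInd ℓ he]
  intro p hp q _ hpq
  by_contra hne
  have hp : ellInd ℓ e p = true := by simpa using hp
  have := congrFun hpq p
  simp [Function.update_of_ne hne, hp] at this

theorem sensSet_update_ellInd {n : ℕ} {G : SimpleGraph (Fin n)} {ℓ : ℕ} (hℓ : 1 ≤ ℓ)
    {e : Sym2 (Fin n)} (he : e ∈ G.edgeSet) {p : Fin (ℓ + 1) × Fin n}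
    (hp : ellInd ℓ e p = true) :
    sensSet (ellIsEdge G ℓ) (ellDom G ℓ) (Function.update (ellInd ℓ e) p false) =
      {ellInd ℓ e} := by
  ext z
  simp only [sensSet, mem_filter, mem_singleton, ellIsEdge_update_ellInd he hp]
  constructor
  · rintro ⟨hz, ⟨i, hi⟩, hf⟩
    simp only [ellDom, mem_filter, mem_univ, true_and] at hz
    obtain ⟨e', he', rfl | ⟨q, hq, rfl⟩⟩ := hz
    · have h := congrArg
        (fun w => Function.update w i (Function.update (ellInd ℓ e) p false i)) hi
      simp only [flipBit_eq_update, Function.update_idem, Function.update_eq_self] at h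
      rw [edge_eq_of_update_ellInd_eq hℓ he' he h]
    · exact absurd (ellIsEdge_update_ellInd he' hq) hf
  · rintro rfl
    refine ⟨ellInd_mem_ellDom ℓ he, ⟨p, ?_⟩, ?_⟩
    · simp only [flipBit_eq_update, Function.update_self, Function.update_idem, Bool.not_false]
      rw [← hp, Function.update_eq_self]
    · rw [ellIsEdge_ellInd ℓ he]
      decide

/-- for a graph `G` with at least one edge and `ℓ ≥ 1`, the maximum
sensitivity of the partial function `ℓ-IsEdge_G : ℓ-D_G → {0,1}` equals `2(ℓ+1)`; every
generalized edge indicator has sensitivity exactly `2(ℓ+1)`, and every sensitive neighbor of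
a generalized edge indicator has sensitivity exactly `1`. -/
theorem stmt10 {n : ℕ} (G : SimpleGraph (Fin n)) (ℓ : ℕ) (hℓ : 1 ≤ ℓ)
    (hE : (edgeFin G).Nonempty) :
    maxSens (ellIsEdge G ℓ) (ellDom G ℓ) = 2 * (ℓ + 1) ∧
    (∀ e ∈ edgeFin G,
      (sensSet (ellIsEdge G ℓ) (ellDom G ℓ) (ellInd ℓ e)).card = 2 * (ℓ + 1)) ∧
    (∀ e ∈ edgeFin G, ∀ y ∈ sensSet (ellIsEdge G ℓ) (ellDom G ℓ) (ellInd ℓ e),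
      (sensSet (ellIsEdge G ℓ) (ellDom G ℓ) y).card = 1) := by
  have hmem : ∀ {e}, e ∈ edgeFin G → e ∈ G.edgeSet := fun h => (mem_filter.1 h).2
  refine ⟨le_antisymm (Finset.sup_le fun x hx => ?_) ?_,
    fun e he => card_sensSet_ellInd hℓ (hmem he), fun e he y hy => ?_⟩
  · simp only [ellDom, mem_filter, mem_univ, true_and] at hx
    obtain ⟨e, he, rfl | ⟨p, hp, rfl⟩⟩ := hx
    · exact (card_sensSet_ellInd hℓ he).le
    · rw [sensSet_update_ellInd hℓ he hp, card_singleton]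
      omega
  · obtain ⟨e, he⟩ := hE
    rw [← card_sensSet_ellInd hℓ (hmem he)]
    exact Finset.le_sup (f := fun x => (sensSet (ellIsEdge G ℓ) (ellDom G ℓ) x).card)
      (ellInd_mem_ellDom ℓ (hmem he))
  · rw [sensSet_ellInd hℓ (hmem he), mem_image] at hy
    obtain ⟨p, hp, rfl⟩ := hy
    rw [sensSet_update_ellInd hℓ (hmem he) (mem_filter.1 hp).2, card_singleton]
end
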